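/- For every natural number k ≥ 1 and every x ∈ [0,1], |v_k(x)| ≤ (1/3) · min(x, 1-x). -/

import Mathlib

/-- The Green function `G₀` of `Lv = -v''` on `(0,1)` with `v(0) = v(1) = 0`. -/
noncomputable def G0 (x ξ : ℝ) : ℝ := if x ≤ ξ then x * (1 - ξ) else ξ * (1 - x)

theorem G0_eq_min_sub_mul (x ξ : ℝ) : G0 x ξ = min x ξ - x * ξ := by
  unfold G0
  split_ifs with h
  · rw [min_eq_left h]; ring
  · rw [min_eq_right (not_le.mp h).le]; ring

theorem continuous_G0_right (x : ℝ) : Continuous (G0 x) := by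
  have h : G0 x = fun ξ => min x ξ - x * ξ := funext (G0_eq_min_sub_mul x)
  rw [h]
  fun_prop

/-- The solution `u` of `-u'' = f`, `u 0 = u 1 = 0`, written without the Green function. -/
noncomputable def greenSolution (f : ℝ → ℝ) (x : ℝ) : ℝ :=
  (1 - x) * (∫ ξ in (0 : ℝ)..x, ξ * f ξ) +
    x * ((∫ ξ in (0 : ℝ)..1, (1 - ξ) * f ξ) - ∫ ξ in (0 : ℝ)..x, (1 - ξ) * f ξ)

/-- The derivative of `greenSolution f`. -/
noncomputable def greenSolutionDeriv (f : ℝ → ℝ) (x : ℝ) : ℝ :=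
  (∫ ξ in (0 : ℝ)..1, (1 - ξ) * f ξ) - (∫ ξ in (0 : ℝ)..x, (1 - ξ) * f ξ) -
    ∫ ξ in (0 : ℝ)..x, ξ * f ξ

theorem greenSolution_zero (f : ℝ → ℝ) : greenSolution f 0 = 0 := by
  simp [greenSolution]

theorem greenSolution_one (f : ℝ → ℝ) : greenSolution f 1 = 0 := by
  simp [greenSolution]

theorem integral_comp_G0 {x : ℝ} (hx : x ∈ Set.Icc (0 : ℝ) 1) (g : ℝ → ℝ → ℝ)
    (hg : Continuous fun ξ => g (G0 x ξ) ξ) :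
    ∫ ξ in (0 : ℝ)..1, g (G0 x ξ) ξ =
      (∫ ξ in (0 : ℝ)..x, g (ξ * (1 - x)) ξ) + ∫ ξ in x..1, g (x * (1 - ξ)) ξ := by
  rw [← intervalIntegral.integral_add_adjacent_intervals (hg.intervalIntegrable 0 x)
    (hg.intervalIntegrable x 1)]
  congr 1
  · refine intervalIntegral.integral_congr fun ξ hξ => ?_
    rw [Set.uIcc_of_le hx.1] at hξ
    have h : G0 x ξ = ξ * (1 - x) := by
      rw [G0_eq_min_sub_mul, min_eq_right hξ.2]; ring
    simp only [h]
  · refine intervalIntegral.integral_congr fun ξ hξ => ?_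
    rw [Set.uIcc_of_le hx.2] at hξ
    have h : G0 x ξ = x * (1 - ξ) := by
      rw [G0_eq_min_sub_mul, min_eq_left hξ.1]; ring
    simp only [h]

theorem integral_G0_mul {f : ℝ → ℝ} (hf : Continuous f) {x : ℝ} (hx : x ∈ Set.Icc (0 : ℝ) 1) :
    ∫ ξ in (0 : ℝ)..1, G0 x ξ * f ξ = greenSolution f x := by
  have hG := continuous_G0_right x
  have hQ : Continuous fun ξ => (1 - ξ) * f ξ := by fun_prop
  rw [integral_comp_G0 hx (fun a ξ => a * f ξ) (by fun_prop), greenSolution,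
    intervalIntegral.integral_interval_sub_left (hQ.intervalIntegrable 0 1)
      (hQ.intervalIntegrable 0 x),
    ← intervalIntegral.integral_const_mul, ← intervalIntegral.integral_const_mul]
  congr 1 <;> exact intervalIntegral.integral_congr fun ξ _ => by ring

theorem integral_G0_sq {x : ℝ} (hx : x ∈ Set.Icc (0 : ℝ) 1) :
    ∫ ξ in (0 : ℝ)..1, G0 x ξ ^ 2 = (x * (1 - x)) ^ 2 / 3 := by
  have hG := continuous_G0_right x
  rw [integral_comp_G0 hx (fun a _ => a ^ 2) (by fun_prop)]
  have h₁ : ∫ ξ in (0 : ℝ)..x, (ξ * (1 - x)) ^ 2 = (1 - x) ^ 2 * x ^ 3 / 3 := by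
    simp_rw [mul_pow]
    rw [intervalIntegral.integral_mul_const, integral_pow]
    norm_num
    ring
  have h₂ : ∫ ξ in x..1, (x * (1 - ξ)) ^ 2 = x ^ 2 * (1 - x) ^ 3 / 3 := by
    simp_rw [mul_pow]
    rw [intervalIntegral.integral_const_mul,
      intervalIntegral.integral_comp_sub_left (fun y : ℝ => y ^ 2) 1, integral_pow]
    norm_num
    ring
  rw [h₁, h₂]
  ring

theorem hasDerivAt_greenSolution {f : ℝ → ℝ} (hf : Continuous f) (x : ℝ) :
    HasDerivAt (greenSolution f) (greenSolutionDeriv f x) x := by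
  have hP : Continuous fun ξ => ξ * f ξ := by fun_prop
  have hQ : Continuous fun ξ => (1 - ξ) * f ξ := by fun_prop
  have h := (((hasDerivAt_id x).const_sub 1).mul (hP.integral_hasStrictDerivAt 0 x).hasDerivAt).add
    ((hasDerivAt_id x).mul ((hQ.integral_hasStrictDerivAt 0 x).hasDerivAt.const_sub
      (∫ ξ in (0 : ℝ)..1, (1 - ξ) * f ξ)))
  refine h.congr_deriv ?_
  simp only [greenSolutionDeriv, id]
  ring

theorem hasDerivAt_greenSolutionDeriv {f : ℝ → ℝ} (hf : Continuous f) (x : ℝ) :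
    HasDerivAt (greenSolutionDeriv f) (-f x) x := by
  have hP : Continuous fun ξ => ξ * f ξ := by fun_prop
  have hQ : Continuous fun ξ => (1 - ξ) * f ξ := by fun_prop
  have h := ((hQ.integral_hasStrictDerivAt 0 x).hasDerivAt.const_sub
      (∫ ξ in (0 : ℝ)..1, (1 - ξ) * f ξ)).sub (hP.integral_hasStrictDerivAt 0 x).hasDerivAt
  exact h.congr_deriv (by ring)

theorem continuous_greenSolution {f : ℝ → ℝ} (hf : Continuous f) : Continuous (greenSolution f) :=
  continuous_iff_continuousAt.2 fun x => (hasDerivAt_greenSolution hf x).continuousAt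

theorem continuous_greenSolutionDeriv {f : ℝ → ℝ} (hf : Continuous f) :
    Continuous (greenSolutionDeriv f) :=
  continuous_iff_continuousAt.2 fun x => (hasDerivAt_greenSolutionDeriv hf x).continuousAt

/-- `f ↦ f - greenSolution f` does not increase the `L²` norm on `[0,1]`. -/
theorem integral_sub_greenSolution_sq_le {f : ℝ → ℝ} (hf : Continuous f) :
    ∫ x in (0 : ℝ)..1, (f x - greenSolution f x) ^ 2 ≤ ∫ x in (0 : ℝ)..1, f x ^ 2 := by
  set u := greenSolution f with hu
  set u' := greenSolutionDeriv f with hu'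
  have hcu : Continuous u := continuous_greenSolution hf
  have hcu' : Continuous u' := continuous_greenSolutionDeriv hf
  have hderiv (x : ℝ) : HasDerivAt (fun x => (2 * x - 1) * u x ^ 2 + 2 * (u x * u' x))
      (2 * u x ^ 2 + 2 * (2 * x - 1) * (u x * u' x) + 2 * u' x ^ 2 - 2 * (u x * f x)) x := by
    have hd := hasDerivAt_greenSolution hf x
    have hd' := hasDerivAt_greenSolutionDeriv hf x
    have h := ((((hasDerivAt_id x).const_mul 2).sub_const 1).mul (hd.pow 2)).add
      ((hd.mul hd').const_mul 2)
    refine h.congr_deriv ?_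
    simp only [← hu, ← hu', id, Pi.pow_apply]
    norm_num
    ring
  have hzero : ∫ x in (0 : ℝ)..1,
      (2 * u x ^ 2 + 2 * (2 * x - 1) * (u x * u' x) + 2 * u' x ^ 2 - 2 * (u x * f x)) = 0 := by
    rw [intervalIntegral.integral_eq_sub_of_hasDerivAt (fun x _ => hderiv x)
      (Continuous.intervalIntegrable (by fun_prop) _ _)]
    simp [hu, greenSolution_zero, greenSolution_one]
  suffices h : 0 ≤ (∫ x in (0 : ℝ)..1, f x ^ 2) + (∫ x in (0 : ℝ)..1,
      (2 * u x ^ 2 + 2 * (2 * x - 1) * (u x * u' x) + 2 * u' x ^ 2 - 2 * (u x * f x))) -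
      ∫ x in (0 : ℝ)..1, (f x - u x) ^ 2 by
    linarith
  rw [← intervalIntegral.integral_add (Continuous.intervalIntegrable (by fun_prop) _ _)
      (Continuous.intervalIntegrable (by fun_prop) _ _),
    ← intervalIntegral.integral_sub (Continuous.intervalIntegrable (by fun_prop) _ _)
      (Continuous.intervalIntegrable (by fun_prop) _ _)]
  refine intervalIntegral.integral_nonneg zero_le_one fun x hx => ?_
  nlinarith [sq_nonneg (2 * u' x + (2 * x - 1) * u x),
    mul_nonneg (mul_nonneg hx.1 (sub_nonneg.2 hx.2)) (sq_nonneg (u x)), sq_nonneg (u x)]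

/-- The iterates of `f ↦ f - greenSolution f` started at the identity function. -/
noncomputable def greenIterate : ℕ → ℝ → ℝ
  | 0 => fun x => x
  | n + 1 => fun x => greenIterate n x - greenSolution (greenIterate n) x

theorem continuous_greenIterate (n : ℕ) : Continuous (greenIterate n) := by
  induction n with
  | zero => exact continuous_id
  | succ n ih => exact ih.sub (continuous_greenSolution ih)

theorem integral_greenIterate_sq_le (n : ℕ) :
    ∫ x in (0 : ℝ)..1, greenIterate n x ^ 2 ≤ 1 / 3 := by
  induction n with
  | zero => simp only [greenIterate, integral_pow]; norm_num
  | succ n ih => exact (integral_sub_greenSolution_sq_le (continuous_greenIterate n)).trans ih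

theorem abs_greenSolution_le {f : ℝ → ℝ} (hf : Continuous f)
    (hf2 : ∫ x in (0 : ℝ)..1, f x ^ 2 ≤ 1 / 3) {x : ℝ} (hx : x ∈ Set.Icc (0 : ℝ) 1) :
    |greenSolution f x| ≤ x * (1 - x) / 3 := by
  rcases eq_or_lt_of_le hx.1 with rfl | h0
  · simp [greenSolution_zero]
  rcases eq_or_lt_of_le hx.2 with rfl | h1
  · simp [greenSolution_one]
  have hs : 0 < x * (1 - x) := mul_pos h0 (sub_pos.2 h1)
  set s := x * (1 - x)
  have hG := continuous_G0_right x
  have key (c : ℝ) : 0 ≤ s ^ 2 / 3 + 2 * c * greenSolution f x +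
      c ^ 2 * ∫ ξ in (0 : ℝ)..1, f ξ ^ 2 := by
    rw [← integral_G0_sq hx, ← integral_G0_mul hf hx, ← intervalIntegral.integral_const_mul,
      ← intervalIntegral.integral_const_mul,
      ← intervalIntegral.integral_add (Continuous.intervalIntegrable (by fun_prop) _ _)
        (Continuous.intervalIntegrable (by fun_prop) _ _),
      ← intervalIntegral.integral_add (Continuous.intervalIntegrable (by fun_prop) _ _)
        (Continuous.intervalIntegrable (by fun_prop) _ _)]
    refine intervalIntegral.integral_nonneg zero_le_one fun ξ _ => ?_
    nlinarith [sq_nonneg (G0 x ξ + c * f ξ)]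
  have hsf := mul_le_mul_of_nonneg_left hf2 (sq_nonneg s)
  rw [abs_le]
  constructor
  · refine le_of_mul_le_mul_left ?_ hs
    linarith [key s]
  · refine le_of_mul_le_mul_left ?_ hs
    linarith [key (-s)]

theorem greenSolution_id (x : ℝ) : greenSolution (fun y => y) x = 1 / 6 * x * (1 - x ^ 2) := by
  have h₁ (b : ℝ) : ∫ ξ in (0 : ℝ)..b, ξ * ξ = b ^ 3 / 3 := by
    simp_rw [← pow_two]
    rw [integral_pow]
    norm_num
  have h₂ (b : ℝ) : ∫ ξ in (0 : ℝ)..b, (1 - ξ) * ξ = b ^ 2 / 2 - b ^ 3 / 3 := by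
    simp_rw [sub_mul, one_mul]
    rw [intervalIntegral.integral_sub (Continuous.intervalIntegrable (by fun_prop) _ _)
      (Continuous.intervalIntegrable (by fun_prop) _ _), h₁, integral_id]
    ring
  rw [greenSolution, h₁, h₂, h₂]
  ring

/-- Weighted estimate (8) of Lemma 4 of the paper: the Meixner-type polynomials
`v_k` satisfy `|v_k(x)| ≤ (1/3)·min(x, 1-x)` for all `k ≥ 1` and `x ∈ [0,1]`. -/
theorem vk_weighted_estimate_third (v : ℕ → ℝ → ℝ)
    (hv0 : ∀ x ∈ Set.Icc (0 : ℝ) 1, v 0 x = x)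
    (hv1 : ∀ x ∈ Set.Icc (0 : ℝ) 1, v 1 x = -(1 / 6) * x * (1 - x ^ 2))
    (hrec : ∀ k, 2 ≤ k → ∀ x ∈ Set.Icc (0 : ℝ) 1,
      v k x = v (k - 1) x - ∫ ξ in (0 : ℝ)..1, G0 x ξ * v (k - 1) ξ)
    (k : ℕ) (hk : 1 ≤ k) (x : ℝ) (hx : x ∈ Set.Icc (0 : ℝ) 1) :
    |v k x| ≤ (1 / 3) * min x (1 - x) := by
  have hrep (n : ℕ) : ∀ y ∈ Set.Icc (0 : ℝ) 1,
      v (n + 1) y = -greenSolution (greenIterate n) y := by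
    induction n with
    | zero =>
      intro y hy
      rw [zero_add, hv1 y hy, greenIterate, greenSolution_id]
      ring
    | succ n ih =>
      intro y hy
      have hw := continuous_greenIterate n
      have hAw := continuous_greenSolution hw
      have hG := continuous_G0_right y
      have hint : ∫ ξ in (0 : ℝ)..1, G0 y ξ * v (n + 1) ξ =
          ∫ ξ in (0 : ℝ)..1, -(G0 y ξ * greenSolution (greenIterate n) ξ) := by
        refine intervalIntegral.integral_congr fun ξ hξ => ?_
        rw [Set.uIcc_of_le zero_le_one] at hξ
        simp only [ih ξ hξ, mul_neg]
      rw [hrec (n + 1 + 1) (by omega) y hy, Nat.add_sub_cancel, ih y hy, hint,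
        intervalIntegral.integral_neg, ← integral_G0_mul hw hy,
        ← integral_G0_mul (continuous_greenIterate (n + 1)) hy]
      simp only [greenIterate, mul_sub]
      rw [intervalIntegral.integral_sub (Continuous.intervalIntegrable (by fun_prop) _ _)
        (Continuous.intervalIntegrable (by fun_prop) _ _)]
      ring
  obtain ⟨n, rfl⟩ := Nat.exists_eq_add_of_le' hk
  rw [hrep n x hx, abs_neg]
  have h := abs_greenSolution_le (continuous_greenIterate n) (integral_greenIterate_sq_le n) hx
  obtain ⟨hx0, hx1⟩ := hx
  rcases min_cases x (1 - x) with ⟨hm, _⟩ | ⟨hm, _⟩ <;> rw [hm] <;> nlinarith
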